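/- (Proposition 2, case k < k̄.) Let k ∈ (0,1) be rational with k < k̄. For each integer N ≥ 1 such that kN is a positive integer, let t_{k,N} denote the unique t > 0 with f_{N,kN}(t) = s. Then t_{k,N} → t̂'_k as N → ∞ along the integers N for which kN is a positive integer. -/

import Mathlib

open Real Filter

/-- Likelihood ratio ℓ_N(K,t). -/
noncomputable def ell (q0 ρH ρL lam : ℝ) (N K : ℕ) (t : ℝ) : ℝ :=
  (q0 / (1 - q0)) * (ρH / ρL) ^ K *
    ((1 - ρH * (1 - Real.exp (-lam * t))) / (1 - ρL * (1 - Real.exp (-lam * t)))) ^ (N - K)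

/-- Belief of good type conditional on state, P_ρ(t). -/
noncomputable def Pst (ρ lam t : ℝ) : ℝ :=
  ρ * Real.exp (-lam * t) / (ρ * Real.exp (-lam * t) + 1 - ρ)

/-- Posterior probability of state H, Q_N(K,t). -/
noncomputable def Q (q0 ρH ρL lam : ℝ) (N K : ℕ) (t : ℝ) : ℝ :=
  ell q0 ρH ρL lam N K t / (1 + ell q0 ρH ρL lam N K t)

/-- Belief of good type G_N(K,t). -/
noncomputable def G (q0 ρH ρL lam : ℝ) (N K : ℕ) (t : ℝ) : ℝ :=
  Q q0 ρH ρL lam N K t * Pst ρH lam t + (1 - Q q0 ρH ρL lam N K t) * Pst ρL lam t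

/-- The function f_{N,M}(t). -/
noncomputable def fNM (q0 ρH ρL lam r z s g : ℝ) (N M : ℕ) (t : ℝ) : ℝ :=
  G q0 ρH ρL lam N (M - 1) t * lam *
    (z + g / r - s / r + ((N : ℝ) - (M : ℝ)) * (G q0 ρH ρL lam N M t * g / r - s / r))

/-- The function φ_k(t). -/
noncomputable def phi (ρH ρL lam k t : ℝ) : ℝ :=
  (ρH / ρL) ^ k *
    ((1 - ρH * (1 - Real.exp (-lam * t))) / (1 - ρL * (1 - Real.exp (-lam * t)))) ^ (1 - k)

/-- The threshold k̂. -/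
noncomputable def khat (ρH ρL : ℝ) : ℝ :=
  Real.log ((1 - ρL) / (1 - ρH)) /
    (Real.log (ρH / ρL) + Real.log ((1 - ρL) / (1 - ρH)))

open Topology

/-- The likelihood ratio contributed by one agent without a success before time `t`. -/
noncomputable def failRatio (ρH ρL lam t : ℝ) : ℝ :=
  (1 - ρH * (1 - Real.exp (-lam * t))) / (1 - ρL * (1 - Real.exp (-lam * t)))

lemma one_sub_mul_one_sub_exp_pos {ρ : ℝ} (lam t : ℝ) (h0 : 0 < ρ) (h1 : ρ < 1) :
    0 < 1 - ρ * (1 - Real.exp (-lam * t)) := by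
  nlinarith [mul_pos h0 (Real.exp_pos (-lam * t))]

section failRatio

variable {ρH ρL lam : ℝ}

lemma failRatio_pos (hρL : 0 < ρL) (hρ : ρL < ρH) (hρH : ρH < 1) (t : ℝ) :
    0 < failRatio ρH ρL lam t :=
  div_pos (one_sub_mul_one_sub_exp_pos lam t (hρL.trans hρ) hρH)
    (one_sub_mul_one_sub_exp_pos lam t hρL (hρ.trans hρH))

lemma failRatio_strictAnti (hlam : 0 < lam) (hρL : 0 < ρL) (hρ : ρL < ρH) (hρH : ρH < 1) :
    StrictAnti (failRatio ρH ρL lam) := by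
  intro x y hxy
  have hE : Real.exp (-lam * y) < Real.exp (-lam * x) := Real.exp_lt_exp.2 (by nlinarith)
  unfold failRatio
  rw [div_lt_div_iff₀ (one_sub_mul_one_sub_exp_pos lam y hρL (hρ.trans hρH))
    (one_sub_mul_one_sub_exp_pos lam x hρL (hρ.trans hρH))]
  nlinarith [mul_pos (sub_pos.2 hE) (sub_pos.2 hρ)]

lemma failRatio_lt_one (hlam : 0 < lam) (hρL : 0 < ρL) (hρ : ρL < ρH) (hρH : ρH < 1)
    {t : ℝ} (ht : 0 < t) : failRatio ρH ρL lam t < 1 := by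
  simpa [failRatio] using failRatio_strictAnti hlam hρL hρ hρH ht

lemma phi_pos (hρL : 0 < ρL) (hρ : ρL < ρH) (hρH : ρH < 1) (k t : ℝ) :
    0 < phi ρH ρL lam k t :=
  mul_pos (Real.rpow_pos_of_pos (div_pos (hρL.trans hρ) hρL) _)
    (Real.rpow_pos_of_pos (failRatio_pos hρL hρ hρH t) _)

lemma phi_strictAnti (hlam : 0 < lam) (hρL : 0 < ρL) (hρ : ρL < ρH) (hρH : ρH < 1)
    {k : ℝ} (hk : k < 1) : StrictAnti (phi ρH ρL lam k) := fun _ y hxy =>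
  mul_lt_mul_of_pos_left
    (Real.rpow_lt_rpow (failRatio_pos hρL hρ hρH y).le
      (failRatio_strictAnti hlam hρL hρ hρH hxy) (sub_pos.2 hk))
    (Real.rpow_pos_of_pos (div_pos (hρL.trans hρ) hρL) _)

lemma phi_strictMono_left (hlam : 0 < lam) (hρL : 0 < ρL) (hρ : ρL < ρH) (hρH : ρH < 1)
    {t : ℝ} (ht : 0 < t) : StrictMono fun k => phi ρH ρL lam k t := fun k l hkl =>
  mul_lt_mul'' (Real.rpow_lt_rpow_of_exponent_lt ((one_lt_div hρL).2 hρ) hkl)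
    (Real.rpow_lt_rpow_of_exponent_gt (failRatio_pos hρL hρ hρH t)
      (failRatio_lt_one hlam hρL hρ hρH ht) (by linarith))
    (Real.rpow_nonneg (div_pos (hρL.trans hρ) hρL).le _)
    (Real.rpow_nonneg (failRatio_pos hρL hρ hρH t).le _)

lemma ell_eq_phi_pow (hρL : 0 < ρL) (hρ : ρL < ρH) (hρH : ρH < 1) (q0 t : ℝ) {k : ℝ}
    {N M : ℕ} (hMN : M ≤ N) (hM : (M : ℝ) = k * N) :
    ell q0 ρH ρL lam N M t = q0 / (1 - q0) * phi ρH ρL lam k t ^ N := by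
  have hA : 0 < ρH / ρL := div_pos (hρL.trans hρ) hρL
  have hR : 0 < failRatio ρH ρL lam t := failRatio_pos hρL hρ hρH t
  have h1 : ((ρH / ρL) ^ k) ^ N = (ρH / ρL) ^ M := by
    rw [← Real.rpow_mul_natCast hA.le, ← hM, Real.rpow_natCast]
  have h2 : (failRatio ρH ρL lam t ^ (1 - k)) ^ N = failRatio ρH ρL lam t ^ (N - M) := by
    rw [← Real.rpow_mul_natCast hR.le, ← Real.rpow_natCast _ (N - M), Nat.cast_sub hMN, hM]
    ring_nf
  unfold failRatio at h2
  unfold ell phi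
  rw [mul_pow, h1, h2, mul_assoc]

lemma ell_pred (q0 t : ℝ) (hρL : 0 < ρL) (hρ : ρL < ρH) {N M : ℕ} (hM : 1 ≤ M) (hMN : M ≤ N) :
    ell q0 ρH ρL lam N (M - 1) t =
      failRatio ρH ρL lam t * (ρL / ρH) * ell q0 ρH ρL lam N M t := by
  obtain ⟨m, rfl⟩ := Nat.exists_eq_add_of_le' hM
  have hA : ρL / ρH * (ρH / ρL) = 1 := by
    rw [div_mul_div_cancel₀ (hρL.trans hρ).ne', div_self hρL.ne']
  have hN : N - (m + 1 - 1) = N - (m + 1) + 1 := by omega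
  unfold ell failRatio
  rw [hN, Nat.add_sub_cancel, pow_succ, pow_succ]
  linear_combination (-(q0 / (1 - q0)) * (ρH / ρL) ^ m *
    ((1 - ρH * (1 - Real.exp (-lam * t))) / (1 - ρL * (1 - Real.exp (-lam * t)))) ^ (N - (m + 1))
    * ((1 - ρH * (1 - Real.exp (-lam * t))) / (1 - ρL * (1 - Real.exp (-lam * t))))) * hA

lemma ell_pos {q0 : ℝ} (hq0 : 0 < q0) (hq1 : q0 < 1) (hρL : 0 < ρL) (hρ : ρL < ρH)
    (hρH : ρH < 1) (N K : ℕ) (t : ℝ) : 0 < ell q0 ρH ρL lam N K t :=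
  mul_pos (mul_pos (div_pos hq0 (sub_pos.2 hq1)) (pow_pos (div_pos (hρL.trans hρ) hρL) _))
    (pow_pos (failRatio_pos hρL hρ hρH t) _)

end failRatio

section Pst

variable {ρ lam : ℝ}

lemma Pst_denom_pos (h0 : 0 < ρ) (h1 : ρ < 1) (t : ℝ) :
    0 < ρ * Real.exp (-lam * t) + 1 - ρ := by
  linarith [mul_pos h0 (Real.exp_pos (-lam * t))]

lemma Pst_pos (h0 : 0 < ρ) (h1 : ρ < 1) (t : ℝ) : 0 < Pst ρ lam t :=
  div_pos (mul_pos h0 (Real.exp_pos _)) (Pst_denom_pos h0 h1 t)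

lemma Pst_lt_one (h0 : 0 < ρ) (h1 : ρ < 1) (t : ℝ) : Pst ρ lam t < 1 := by
  rw [Pst, div_lt_one (Pst_denom_pos h0 h1 t)]
  linarith

lemma Pst_strictAnti (hlam : 0 < lam) (h0 : 0 < ρ) (h1 : ρ < 1) : StrictAnti (Pst ρ lam) := by
  intro x y hxy
  have hE : Real.exp (-lam * y) < Real.exp (-lam * x) := Real.exp_lt_exp.2 (by nlinarith)
  unfold Pst
  rw [div_lt_div_iff₀ (Pst_denom_pos h0 h1 y) (Pst_denom_pos h0 h1 x)]
  nlinarith [mul_pos (mul_pos h0 (sub_pos.2 h1)) (sub_pos.2 hE)]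

lemma Pst_lt_prior (hlam : 0 < lam) (h0 : 0 < ρ) (h1 : ρ < 1) {t : ℝ} (ht : 0 < t) :
    Pst ρ lam t < ρ := by
  simpa [Pst] using Pst_strictAnti hlam h0 h1 ht

end Pst

section belief

variable {q0 ρH ρL lam : ℝ}

lemma Q_pos (hq0 : 0 < q0) (hq1 : q0 < 1) (hρL : 0 < ρL) (hρ : ρL < ρH) (hρH : ρH < 1)
    (N K : ℕ) (t : ℝ) : 0 < Q q0 ρH ρL lam N K t := by
  have h := ell_pos (lam := lam) hq0 hq1 hρL hρ hρH N K t
  unfold Q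
  positivity

lemma Q_lt_one (hq0 : 0 < q0) (hq1 : q0 < 1) (hρL : 0 < ρL) (hρ : ρL < ρH) (hρH : ρH < 1)
    (N K : ℕ) (t : ℝ) : Q q0 ρH ρL lam N K t < 1 := by
  have h := ell_pos (lam := lam) hq0 hq1 hρL hρ hρH N K t
  rw [Q, div_lt_one (by linarith)]
  linarith

lemma Q_mul_Pst_lt_G (hq0 : 0 < q0) (hq1 : q0 < 1) (hρL : 0 < ρL) (hρ : ρL < ρH) (hρH : ρH < 1)
    (N K : ℕ) (t : ℝ) :
    Q q0 ρH ρL lam N K t * Pst ρH lam t < G q0 ρH ρL lam N K t :=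
  lt_add_of_pos_right _ (mul_pos (sub_pos.2 (Q_lt_one hq0 hq1 hρL hρ hρH N K t))
    (Pst_pos hρL (hρ.trans hρH) t))

lemma G_pos (hq0 : 0 < q0) (hq1 : q0 < 1) (hρL : 0 < ρL) (hρ : ρL < ρH) (hρH : ρH < 1)
    (N K : ℕ) (t : ℝ) : 0 < G q0 ρH ρL lam N K t :=
  (mul_pos (Q_pos hq0 hq1 hρL hρ hρH N K t) (Pst_pos (hρL.trans hρ) hρH t)).trans
    (Q_mul_Pst_lt_G hq0 hq1 hρL hρ hρH N K t)

lemma G_lt_ell_add (hlam : 0 < lam) (hq0 : 0 < q0) (hq1 : q0 < 1) (hρL : 0 < ρL)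
    (hρ : ρL < ρH) (hρH : ρH < 1) (N K : ℕ) {t : ℝ} (ht : 0 < t) :
    G q0 ρH ρL lam N K t < ell q0 ρH ρL lam N K t + ρL := by
  have hQ := Q_pos (lam := lam) hq0 hq1 hρL hρ hρH N K t
  have hQ1 := Q_lt_one (lam := lam) hq0 hq1 hρL hρ hρH N K t
  have hl := ell_pos (lam := lam) hq0 hq1 hρL hρ hρH N K t
  have hQl : Q q0 ρH ρL lam N K t ≤ ell q0 ρH ρL lam N K t :=
    div_le_self hl.le (by linarith)
  have hP := Pst_lt_one (lam := lam) (hρL.trans hρ) hρH t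
  have hP' := Pst_lt_prior hlam hρL (hρ.trans hρH) ht
  unfold G
  nlinarith

/-- A sufficiently large likelihood ratio pushes the belief above any level below `Pst ρH lam a`,
uniformly for times up to `a`. -/
lemma lt_G_of_le (hlam : 0 < lam) (hq0 : 0 < q0) (hq1 : q0 < 1) (hρL : 0 < ρL)
    (hρ : ρL < ρH) (hρH : ρH < 1) {N K : ℕ} {t a c : ℝ} (hta : t ≤ a)
    (h : c < ell q0 ρH ρL lam N K t * (Pst ρH lam a - c)) :
    c < G q0 ρH ρL lam N K t := by
  have hl := ell_pos (lam := lam) hq0 hq1 hρL hρ hρH N K t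
  have hP : Pst ρH lam a ≤ Pst ρH lam t :=
    (Pst_strictAnti hlam (hρL.trans hρ) hρH).antitone hta
  refine lt_trans ?_ (Q_mul_Pst_lt_G hq0 hq1 hρL hρ hρH N K t)
  rw [Q, div_mul_eq_mul_div, lt_div_iff₀ (by linarith)]
  nlinarith

end belief

section cutoff

variable {lam q0 ρH ρL r z s g k : ℝ}

lemma eventually_lt_fNM (hlam : 0 < lam) (hq0 : 0 < q0) (hq1 : q0 < 1)
    (hρL : 0 < ρL) (hρ : ρL < ρH) (hρH : ρH < 1) (hr : 0 < r) (hz : 0 < z)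
    (hg : g = lam * z) (hgs : ρH * g > s) (hk1 : k < 1) {a : ℝ}
    (hphi : 1 < phi ρH ρL lam k a) (hP : s / g < Pst ρH lam a) :
    ∀ᶠ N : ℕ in atTop, ∀ (M : ℕ) (t : ℝ), 1 ≤ M → (M : ℝ) = k * N → t ≤ a →
      s < fNM q0 ρH ρL lam r z s g N M t := by
  have hg0 : 0 < g := hg ▸ mul_pos hlam hz
  have hc : 0 < q0 / (1 - q0) := div_pos hq0 (sub_pos.2 hq1)
  have hd : 0 < Pst ρH lam a - s / g := sub_pos.2 hP
  have hRa : 0 < failRatio ρH ρL lam a := failRatio_pos hρL hρ hρH a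
  have hAinv : 0 < ρL / ρH := div_pos hρL (hρL.trans hρ)
  have hlim : Tendsto (fun N : ℕ => q0 / (1 - q0) * phi ρH ρL lam k a ^ N) atTop atTop :=
    (tendsto_pow_atTop_atTop_of_one_lt hphi).const_mul_atTop hc
  have e1 := (hlim.atTop_mul_const hd).eventually_gt_atTop (s / g)
  have e2 := ((hlim.const_mul_atTop (mul_pos hRa hAinv)).atTop_mul_const hd).eventually_gt_atTop
    (s / g)
  filter_upwards [e1, e2] with N h1 h2 M t hM hMk hta
  have hMN' : (M : ℝ) ≤ N := by
    rw [hMk]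
    exact mul_le_of_le_one_left N.cast_nonneg hk1.le
  have hMN : M ≤ N := by exact_mod_cast hMN'
  have hell : q0 / (1 - q0) * phi ρH ρL lam k a ^ N ≤ ell q0 ρH ρL lam N M t := by
    rw [ell_eq_phi_pow hρL hρ hρH q0 t hMN hMk]
    have := (phi_strictAnti hlam hρL hρ hρH hk1).antitone hta
    gcongr
  have hRt : failRatio ρH ρL lam a ≤ failRatio ρH ρL lam t :=
    (failRatio_strictAnti hlam hρL hρ hρH).antitone hta
  have hG : s / g < G q0 ρH ρL lam N M t :=
    lt_G_of_le hlam hq0 hq1 hρL hρ hρH hta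
      (h1.trans_le (mul_le_mul_of_nonneg_right hell hd.le))
  have hG' : s / g < G q0 ρH ρL lam N (M - 1) t := by
    refine lt_G_of_le hlam hq0 hq1 hρL hρ hρH hta (h2.trans_le ?_)
    rw [ell_pred q0 t hρL hρ hM hMN]
    have hpos := (phi_pos (lam := lam) hρL hρ hρH k a).le
    have hRt0 := failRatio_pos (lam := lam) hρL hρ hρH t
    gcongr
  have hsg : s < g := by nlinarith
  have hGg : 0 ≤ G q0 ρH ρL lam N M t * g / r - s / r := by
    rw [← sub_div]
    exact div_nonneg (by linarith [(div_lt_iff₀ hg0).1 hG]) hr.le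
  have hbr : z ≤ z + g / r - s / r +
      ((N : ℝ) - (M : ℝ)) * (G q0 ρH ρL lam N M t * g / r - s / r) := by
    have h3 : 0 ≤ g / r - s / r := by
      rw [← sub_div]
      exact div_nonneg (by linarith) hr.le
    have h4 := mul_nonneg (sub_nonneg.2 hMN') hGg
    linarith
  have hGpos := G_pos (lam := lam) hq0 hq1 hρL hρ hρH N (M - 1) t
  calc s < G q0 ρH ρL lam N (M - 1) t * g := (div_lt_iff₀ hg0).1 hG'
    _ = G q0 ρH ρL lam N (M - 1) t * lam * z := by rw [hg, mul_assoc]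
    _ ≤ _ := mul_le_mul_of_nonneg_left hbr (mul_pos hGpos hlam).le

lemma eventually_fNM_neg (hlam : 0 < lam) (hq0 : 0 < q0) (hq1 : q0 < 1)
    (hρL : 0 < ρL) (hρ : ρL < ρH) (hρH : ρH < 1) (hr : 0 < r) (hg0 : 0 < g)
    (hsg : s > ρL * g) (hk1 : k < 1) {b : ℝ} (hb : 0 < b)
    (hphi : phi ρH ρL lam k b < 1) :
    ∀ᶠ N : ℕ in atTop, ∀ (M : ℕ) (t : ℝ), (M : ℝ) = k * N → b ≤ t →
      fNM q0 ρH ρL lam r z s g N M t < 0 := by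
  have hc : 0 < q0 / (1 - q0) := div_pos hq0 (sub_pos.2 hq1)
  set d : ℝ := (s - ρL * g) / 2 with hd_def
  have hd : 0 < d := half_pos (sub_pos.2 hsg)
  have hlim : Tendsto (fun N : ℕ => q0 / (1 - q0) * phi ρH ρL lam k b ^ N * g) atTop (𝓝 0) := by
    simpa using ((tendsto_pow_atTop_nhds_zero_of_lt_one (phi_pos hρL hρ hρH k b).le
      hphi).const_mul (q0 / (1 - q0))).mul_const g
  have e1 := hlim.eventually_lt_const hd
  have e2 := ((tendsto_natCast_atTop_atTop (R := ℝ)).const_mul_atTop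
    (mul_pos (sub_pos.2 hk1) (div_pos hd hr))).eventually_gt_atTop (z + g / r - s / r)
  filter_upwards [e1, e2] with N h1 h2 M t hMk hbt
  have hMN' : (M : ℝ) ≤ N := by
    rw [hMk]
    exact mul_le_of_le_one_left N.cast_nonneg hk1.le
  have hMN : M ≤ N := by exact_mod_cast hMN'
  have hell : ell q0 ρH ρL lam N M t * g ≤ q0 / (1 - q0) * phi ρH ρL lam k b ^ N * g := by
    rw [ell_eq_phi_pow hρL hρ hρH q0 t hMN hMk]
    have := (phi_strictAnti hlam hρL hρ hρH hk1).antitone hbt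
    have := (phi_pos (lam := lam) hρL hρ hρH k t).le
    gcongr
  have hG : G q0 ρH ρL lam N M t * g - s ≤ -d := by
    have := mul_lt_mul_of_pos_right
      (G_lt_ell_add hlam hq0 hq1 hρL hρ hρH N M (hb.trans_le hbt)) hg0
    linarith
  have hG' : G q0 ρH ρL lam N M t * g / r - s / r ≤ -(d / r) := by
    rw [← sub_div, ← neg_div]
    gcongr
  refine mul_neg_of_pos_of_neg
    (mul_pos (G_pos hq0 hq1 hρL hρ hρH N (M - 1) t) hlam) ?_
  have h3 := mul_le_mul_of_nonneg_left hG' (sub_nonneg.2 hMN')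
  have h4 : ((N : ℝ) - M) * -(d / r) = -((1 - k) * (d / r) * N) := by
    rw [hMk]
    ring
  linarith

end cutoff

/-- Proposition 2, case k < k̄: for rational k ∈ (0, k̄), the
equilibrium cut-offs t_{k,N} (the unique positive solutions of
f_{N,kN}(t) = s) converge to t̂'_k along the integers N for which kN is a
positive integer. -/
theorem limit_cutoff_below_kbar
    (lam q0 ρH ρL r z s g : ℝ) (hlam : 0 < lam) (hq0 : 0 < q0) (hq1 : q0 < 1)
    (hρL : 0 < ρL) (hρ : ρL < ρH) (hρH : ρH < 1)
    (hr : 0 < r) (hz : 0 < z) (hs : 0 < s) (hg : g = lam * z)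
    (hgs : ρH * g > s) (hsg : s > ρL * g)
    (hprior : q0 * ρH * g + (1 - q0) * ρL * g > s)
    (tbar : ℝ) (htbar : 0 < tbar ∧ Pst ρH lam tbar = s / g)
    (kbar : ℝ)
    (hkbar : (0 < kbar ∧ kbar < khat ρH ρL) ∧ phi ρH ρL lam kbar tbar = 1)
    (k : ℚ) (hk0 : 0 < (k : ℝ)) (hk1 : (k : ℝ) < 1) (hkk : (k : ℝ) < kbar)
    (tk : ℝ) (htk : 0 < tk ∧ phi ρH ρL lam (k : ℝ) tk = 1)
    (tkN : ℕ → ℝ)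
    (htkN : ∀ N M : ℕ, 1 ≤ N → 1 ≤ M → (M : ℝ) = (k : ℝ) * N →
      0 < tkN N ∧ fNM q0 ρH ρL lam r z s g N M (tkN N) = s) :
    Tendsto tkN
      (atTop ⊓ Filter.principal {N : ℕ | ∃ M : ℕ, 1 ≤ M ∧ (M : ℝ) = (k : ℝ) * N})
      (nhds tk) := by
  have hg0 : 0 < g := hg ▸ mul_pos hlam hz
  have hanti := phi_strictAnti hlam hρL hρ hρH hk1
  have htkbar : tk < tbar := by
    rw [← hanti.lt_iff_gt, htk.2, ← hkbar.2]
    exact phi_strictMono_left hlam hρL hρ hρH htbar.1 hkk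
  have hN : ∀ N M : ℕ, 1 ≤ M → (M : ℝ) = (k : ℝ) * N → 1 ≤ N := by
    rintro (_ | N) M hM hMk
    · have : M = 0 := by simpa using hMk
      omega
    · omega
  refine tendsto_order.2 ⟨fun a ha => ?_, fun b hb => ?_⟩ <;> rw [eventually_inf_principal]
  · have hP : s / g < Pst ρH lam a := by
      rw [← htbar.2]
      exact Pst_strictAnti hlam (hρL.trans hρ) hρH (ha.trans htkbar)
    filter_upwards [eventually_lt_fNM hlam hq0 hq1 hρL hρ hρH hr hz hg hgs hk1
      (htk.2 ▸ hanti ha) hP] with N h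
    rintro ⟨M, hM, hMk⟩
    by_contra! hle
    exact (h M _ hM hMk hle).ne' (htkN N M (hN N M hM hMk) hM hMk).2
  · filter_upwards [eventually_fNM_neg (z := z) hlam hq0 hq1 hρL hρ hρH hr hg0 hsg hk1
      (htk.1.trans hb) (htk.2 ▸ hanti hb)] with N h
    rintro ⟨M, hM, hMk⟩
    by_contra! hle
    exact ((h M _ hMk hle).trans hs).ne (htkN N M (hN N M hM hMk) hM hMk).2
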